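/- Properties of the generalized effective Hamiltonian: (1) |H̄_∞(P) − H̄_∞(Q)| ≤ σ̄ L |P − Q| for all P, Q ∈ ℝ^N, where L is the Lipschitz constant of m; (2) H̄_∞(k P) ≥ H̄_∞(P) for all P ∈ ℝ^N and all real k ≥ 1; (3) H̄_∞(P) = H̄_∞(−P) for all P ∈ ℝ^N. -/

import Mathlib

open Set Filter MeasureTheory

noncomputable section

abbrev Euc (N : ℕ) := EuclideanSpace ℝ (Fin N)

def intVec {N : ℕ} (z : Fin N → ℤ) : Euc N :=
  (EuclideanSpace.equiv (Fin N) ℝ).symm (fun i => (z i : ℝ))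

def IsZPeriodic {N : ℕ} (u : Euc N → ℝ) : Prop :=
  ∀ (x : Euc N) (z : Fin N → ℤ), u (x + intVec z) = u x

def IsZPeriodicH {N : ℕ} (H : Euc N → Euc N → ℝ) : Prop :=
  ∀ (x p : Euc N) (z : Fin N → ℤ), H (x + intVec z) p = H x p

def superDiff {N : ℕ} (u : Euc N → ℝ) (x : Euc N) : Set (Euc N) :=
  { q | ∃ φ : Euc N → ℝ, ContDiff ℝ 1 φ ∧ IsZPeriodic φ ∧
        (∀ y, u y - φ y ≤ u x - φ x) ∧ q = gradient φ x }

def subDiff {N : ℕ} (u : Euc N → ℝ) (x : Euc N) : Set (Euc N) :=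
  { q | ∃ φ : Euc N → ℝ, ContDiff ℝ 1 φ ∧ IsZPeriodic φ ∧
        (∀ y, u x - φ x ≤ u y - φ y) ∧ q = gradient φ x }

def IsCellSubsolution {N : ℕ} (H : Euc N → Euc N → ℝ) (P : Euc N) (a : ℝ) (u : Euc N → ℝ) : Prop :=
  ∀ x, ∀ q ∈ superDiff u x, H x (q + P) ≤ a

def IsCellSupersolution {N : ℕ} (H : Euc N → Euc N → ℝ) (P : Euc N) (a : ℝ) (u : Euc N → ℝ) : Prop :=
  ∀ x, ∀ q ∈ subDiff u x, a ≤ H x (q + P)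

def IsCellSolution {N : ℕ} (H : Euc N → Euc N → ℝ) (P : Euc N) (u : Euc N → ℝ) (a : ℝ) : Prop :=
  (∃ K : NNReal, LipschitzWith K u) ∧ IsZPeriodic u ∧
    IsCellSubsolution H P a u ∧ IsCellSupersolution H P a u

def IsCoerciveH {N : ℕ} (H : Euc N → Euc N → ℝ) : Prop :=
  ∀ C : ℝ, ∃ r : ℝ, ∀ x p : Euc N, r ≤ ‖p‖ → C ≤ H x p

lemma intVec_apply {N : ℕ} (z : Fin N → ℤ) (i : Fin N) : intVec z i = (z i : ℝ) := rfl

/-- A smooth periodic function on `Euc N`, comparable to the squared distance to the lattice. -/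
def latticeSq {N : ℕ} (z : Euc N) : ℝ :=
  ∑ i, (1 - Real.cos (2 * Real.pi * z i)) / (2 * Real.pi ^ 2)

/-- A smooth periodic map which agrees with the identity to first order at the origin. -/
def sinVec {N : ℕ} (z : Euc N) : Euc N :=
  WithLp.toLp 2 fun i => Real.sin (2 * Real.pi * z i) / (2 * Real.pi)

/-- A smooth periodic function whose gradient at the origin is `P`. -/
def sinLin {N : ℕ} (P z : Euc N) : ℝ :=
  ∑ i, P i * (Real.sin (2 * Real.pi * z i) / (2 * Real.pi))

lemma cos_shift (a : ℝ) (k : ℤ) :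
    Real.cos (2 * Real.pi * (a + k)) = Real.cos (2 * Real.pi * a) := by
  rw [← Real.cos_add_int_mul_two_pi (2 * Real.pi * a) k]; ring_nf

lemma sin_shift (a : ℝ) (k : ℤ) :
    Real.sin (2 * Real.pi * (a + k)) = Real.sin (2 * Real.pi * a) := by
  rw [← Real.sin_add_int_mul_two_pi (2 * Real.pi * a) k]; ring_nf

lemma latticeSq_periodic {N : ℕ} : IsZPeriodic (latticeSq (N := N)) := by
  intro x z
  simp [latticeSq, intVec_apply, cos_shift]

lemma sinLin_periodic {N : ℕ} (P : Euc N) : IsZPeriodic (sinLin P) := by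
  intro x z
  simp [sinLin, intVec_apply, sin_shift]

lemma latticeSq_neg {N : ℕ} (z : Euc N) : latticeSq (-z) = latticeSq z := by
  simp [latticeSq]

lemma latticeSq_zero {N : ℕ} : latticeSq (0 : Euc N) = 0 := by
  simp [latticeSq]

lemma sinLin_zero {N : ℕ} (P : Euc N) : sinLin P 0 = 0 := by
  simp [sinLin]

lemma contDiff_latticeSq {N : ℕ} : ContDiff ℝ 1 (latticeSq (N := N)) := by
  unfold latticeSq
  fun_prop

lemma contDiff_sinLin {N : ℕ} (P : Euc N) : ContDiff ℝ 1 (sinLin P) := by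
  unfold sinLin
  fun_prop

lemma latticeSq_term_nonneg (a : ℝ) :
    0 ≤ (1 - Real.cos (2 * Real.pi * a)) / (2 * Real.pi ^ 2) :=
  div_nonneg (sub_nonneg.2 (Real.cos_le_one _)) (by positivity)

lemma latticeSq_nonneg {N : ℕ} (z : Euc N) : 0 ≤ latticeSq z :=
  Finset.sum_nonneg fun i _ => latticeSq_term_nonneg (z i)

lemma latticeSq_term_le {N : ℕ} (z : Euc N) (i : Fin N) :
    (1 - Real.cos (2 * Real.pi * z i)) / (2 * Real.pi ^ 2) ≤ latticeSq z :=
  Finset.single_le_sum (f := fun i => (1 - Real.cos (2 * Real.pi * z i)) / (2 * Real.pi ^ 2))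
    (fun i _ => latticeSq_term_nonneg (z i)) (Finset.mem_univ i)

lemma latticeSq_le_norm_sq {N : ℕ} (z : Euc N) : latticeSq z ≤ ‖z‖ ^ 2 := by
  rw [EuclideanSpace.norm_sq_eq]
  refine Finset.sum_le_sum fun i _ => ?_
  have h := Real.one_sub_sq_div_two_le_cos (x := 2 * Real.pi * z i)
  rw [div_le_iff₀ (by positivity), Real.norm_eq_abs, sq_abs]
  nlinarith

lemma sinVec_sq_term (a : ℝ) :
    (Real.sin (2 * Real.pi * a) / (2 * Real.pi)) ^ 2 =
      (1 - Real.cos (2 * Real.pi * a)) / (2 * Real.pi ^ 2) *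
        (1 - Real.pi ^ 2 * ((1 - Real.cos (2 * Real.pi * a)) / (2 * Real.pi ^ 2))) := by
  have hs := Real.sin_sq_add_cos_sq (2 * Real.pi * a)
  have hpi := Real.pi_ne_zero
  field_simp
  linear_combination hs

lemma norm_sinVec_sq {N : ℕ} (z : Euc N) :
    ‖sinVec z‖ ^ 2 = ∑ i, (Real.sin (2 * Real.pi * z i) / (2 * Real.pi)) ^ 2 := by
  simp only [EuclideanSpace.norm_sq_eq, sinVec, Real.norm_eq_abs, sq_abs]

lemma norm_sinVec_sq_le {N : ℕ} (z : Euc N) : ‖sinVec z‖ ^ 2 ≤ latticeSq z := by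
  rw [norm_sinVec_sq]
  refine Finset.sum_le_sum fun i _ => ?_
  rw [sinVec_sq_term]
  have h := latticeSq_term_nonneg (z i)
  nlinarith [mul_nonneg (sq_nonneg Real.pi) (mul_nonneg h h)]

lemma norm_sinVec_le {N : ℕ} (z : Euc N) : ‖sinVec z‖ ≤ √(latticeSq z) :=
  Real.le_sqrt_of_sq_le (norm_sinVec_sq_le z)

lemma le_norm_sinVec_sq {N : ℕ} (z : Euc N) :
    latticeSq z * (1 - Real.pi ^ 2 * latticeSq z) ≤ ‖sinVec z‖ ^ 2 := by
  rw [norm_sinVec_sq]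
  nth_rewrite 1 [latticeSq]
  rw [Finset.sum_mul]
  refine Finset.sum_le_sum fun i _ => ?_
  rw [sinVec_sq_term]
  have := latticeSq_term_le z i
  have := latticeSq_term_nonneg (z i)
  gcongr

lemma le_norm_sinVec {N : ℕ} (z : Euc N) :
    √(latticeSq z) * (1 - Real.pi ^ 2 * latticeSq z) ≤ ‖sinVec z‖ := by
  have h0 := latticeSq_nonneg z
  rcases le_or_gt (1 - Real.pi ^ 2 * latticeSq z) 0 with h | h
  · exact (mul_nonpos_of_nonneg_of_nonpos (Real.sqrt_nonneg _) h).trans (norm_nonneg _)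
  · refine abs_le_of_sq_le_sq' ?_ (norm_nonneg _) |>.2
    refine le_trans ?_ (le_norm_sinVec_sq z)
    rw [mul_pow, Real.sq_sqrt h0]
    have : 0 ≤ Real.pi ^ 2 * latticeSq z := by positivity
    gcongr
    nlinarith

lemma abs_sinLin_le {N : ℕ} (P z : Euc N) : |sinLin P z| ≤ ‖P‖ * √(latticeSq z) := by
  have h : sinLin P z = inner ℝ P (sinVec z) := by
    simp [sinLin, sinVec, PiLp.inner_apply, mul_comm]
  rw [h]
  exact (abs_real_inner_le_norm _ _).trans
    (mul_le_mul_of_nonneg_left (norm_sinVec_le z) (norm_nonneg _))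

lemma exists_intVec_norm_le {N : ℕ} (x : Euc N) :
    ∃ z : Fin N → ℤ, ‖x + intVec z‖ ≤ 2 * √(latticeSq x) := by
  refine ⟨fun i => -round (x i), ?_⟩
  rw [← latticeSq_periodic x (fun i => -round (x i))]
  set y := x + intVec (fun i => -round (x i)) with hy
  have hyi : ∀ i, |y i| ≤ 1 / 2 := by
    intro i
    have := abs_sub_round (x i)
    simpa [hy, intVec_apply, sub_eq_add_neg] using this
  have h : ‖y‖ ^ 2 ≤ 4 * latticeSq y := by
    rw [EuclideanSpace.norm_sq_eq, latticeSq, Finset.mul_sum]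
    refine Finset.sum_le_sum fun i _ => ?_
    have hpi := Real.pi_pos
    have h1 : |2 * Real.pi * y i| ≤ Real.pi := by
      rw [abs_mul, abs_of_pos (by positivity)]
      nlinarith [hyi i]
    have h2 := Real.cos_le_one_sub_mul_cos_sq h1
    have h3 : 2 / Real.pi ^ 2 * (2 * Real.pi * y i) ^ 2 = 8 * y i ^ 2 := by
      field_simp; ring
    rw [Real.norm_eq_abs, sq_abs, ← mul_div_assoc, le_div_iff₀ (by positivity)]
    have h4 : Real.pi ^ 2 ≤ 16 := by nlinarith [Real.pi_le_four]
    nlinarith [sq_nonneg (y i)]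
  have h0 := latticeSq_nonneg y
  refine abs_le_of_sq_le_sq' ?_ (by positivity) |>.2
  rw [mul_pow, Real.sq_sqrt h0]
  linarith

lemma exists_intVec_norm_le_const (N : ℕ) :
    ∃ R : ℝ, ∀ x : Euc N, ∃ z : Fin N → ℤ, ‖x + intVec z‖ ≤ R := by
  refine ⟨2 * √(∑ _i : Fin N, 1), fun x => ?_⟩
  obtain ⟨z, hz⟩ := exists_intVec_norm_le x
  refine ⟨z, hz.trans ?_⟩
  gcongr
  refine Finset.sum_le_sum fun i _ => ?_
  rw [div_le_one (by positivity)]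
  nlinarith [Real.neg_one_le_cos (2 * Real.pi * x i), Real.pi_gt_three]

lemma exists_max_of_periodic_prod {N : ℕ} {F : Euc N × Euc N → ℝ} (hF : Continuous F)
    (h1 : ∀ y, IsZPeriodic fun x => F (x, y)) (h2 : ∀ x, IsZPeriodic fun y => F (x, y)) :
    ∃ x y, ∀ x' y', F (x', y') ≤ F (x, y) := by
  obtain ⟨R, hR⟩ := exists_intVec_norm_le_const N
  have hc : IsCompact (Metric.closedBall (0 : Euc N) R ×ˢ Metric.closedBall (0 : Euc N) R) :=
    (isCompact_closedBall _ _).prod (isCompact_closedBall _ _)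
  obtain ⟨z0, hz0⟩ := hR 0
  obtain ⟨⟨x, y⟩, -, hxy⟩ := hc.exists_isMaxOn
    ⟨(0 + intVec z0, 0 + intVec z0), by simpa using hz0⟩ hF.continuousOn
  refine ⟨x, y, fun x' y' => ?_⟩
  obtain ⟨z, hz⟩ := hR x'
  obtain ⟨w, hw⟩ := hR y'
  have e1 : F (x' + intVec z, y' + intVec w) = F (x', y' + intVec w) := h1 _ x' z
  have e2 : F (x', y' + intVec w) = F (x', y') := h2 _ y' w
  rw [← e2, ← e1]
  exact hxy ⟨by simpa using hz, by simpa using hw⟩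

lemma exists_max_of_periodic {N : ℕ} {f : Euc N → ℝ} (hf : Continuous f) (hp : IsZPeriodic f) :
    ∃ x, ∀ y, f y ≤ f x := by
  obtain ⟨x, _, h⟩ := exists_max_of_periodic_prod (F := fun p => f p.1) (by fun_prop)
    (fun _ => hp) (fun _ _ _ => rfl)
  exact ⟨x, fun y => h y y⟩

lemma LipschitzWith.abs_sub_le_latticeSq {N : ℕ} {u : Euc N → ℝ} {K : NNReal}
    (hu : LipschitzWith K u) (hp : IsZPeriodic u) (x y : Euc N) :
    |u x - u y| ≤ 2 * K * √(latticeSq (x - y)) := by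
  obtain ⟨z, hz⟩ := exists_intVec_norm_le (x - y)
  have h := hu.dist_le_mul (x + intVec z) y
  rw [hp, Real.dist_eq, dist_eq_norm, add_sub_right_comm] at h
  nlinarith [K.coe_nonneg]

lemma exists_latticeSq_modulus {N : ℕ} {f : Euc N → ℝ} (hf : Continuous f) (hp : IsZPeriodic f)
    {η : ℝ} (hη : 0 < η) :
    ∃ ρ > 0, ∀ x y, latticeSq (x - y) ≤ ρ → |f x - f y| ≤ η := by
  obtain ⟨R, hR⟩ := exists_intVec_norm_le_const N
  have huc := (isCompact_closedBall (0 : Euc N) (R + 1)).uniformContinuousOn_of_continuous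
    hf.continuousOn
  obtain ⟨d, hd, h⟩ := Metric.uniformContinuousOn_iff.1 huc η hη
  set e := min d 1 with he
  have he0 : 0 < e := lt_min hd one_pos
  refine ⟨(e / 4) ^ 2, by positivity, fun x y hxy => ?_⟩
  obtain ⟨w, hw⟩ := hR y
  obtain ⟨z, hz⟩ := exists_intVec_norm_le (x + intVec w - (y + intVec w))
  have hsq : √(latticeSq (x - y)) ≤ e / 4 := by
    rw [Real.sqrt_le_left (by positivity)]; exact hxy
  rw [add_sub_add_right_eq_sub] at hz
  have hz' : ‖x + intVec w + intVec z - (y + intVec w)‖ < e := by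
    rw [show x + intVec w + intVec z - (y + intVec w) = x - y + intVec z by abel]
    linarith
  have hn : ‖x + intVec w + intVec z‖ ≤ R + 1 := by
    have := norm_add_le (x + intVec w + intVec z - (y + intVec w)) (y + intVec w)
    rw [sub_add_cancel] at this
    linarith [min_le_right d 1]
  have := h (x + intVec w + intVec z) (by simpa using hn) (y + intVec w)
    (by simpa using hw.trans (by linarith)) (by
      rw [dist_eq_norm]; exact hz'.trans_le (min_le_left _ _))
  rw [hp, hp, hp, Real.dist_eq] at this
  exact this.le

lemma hasGradientAt_sum_coord {N : ℕ} {h : Fin N → ℝ → ℝ} {d : Fin N → ℝ} {z : Euc N}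
    (hd : ∀ i, HasDerivAt (h i) (d i) (z i)) :
    HasGradientAt (fun z : Euc N => ∑ i, h i (z i)) (WithLp.toLp 2 d) z := by
  rw [hasGradientAt_iff_hasFDerivAt]
  have h1 : HasFDerivAt (fun z : Euc N => ∑ i, h i (z i))
      (∑ i, d i • (EuclideanSpace.proj i : Euc N →L[ℝ] ℝ)) z := by
    refine HasFDerivAt.fun_sum fun i _ => ?_
    exact (hd i).comp_hasFDerivAt z (EuclideanSpace.proj i : Euc N →L[ℝ] ℝ).hasFDerivAt
  refine h1.congr_fderiv (Eq.symm ?_)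
  ext v
  simp [PiLp.inner_apply, mul_comm]

lemma hasGradientAt_latticeSq {N : ℕ} (z : Euc N) :
    HasGradientAt latticeSq ((2 : ℝ) • sinVec z) z := by
  have : ((2 : ℝ) • sinVec z) =
      WithLp.toLp 2 fun i => 2 * (Real.sin (2 * Real.pi * z i) / (2 * Real.pi)) := by
    ext i; simp [sinVec]
  rw [this]
  refine hasGradientAt_sum_coord
    (h := fun _ a => (1 - Real.cos (2 * Real.pi * a)) / (2 * Real.pi ^ 2)) fun i => ?_
  have h1 := (((hasDerivAt_id (z i)).const_mul (2 * Real.pi)).cos.const_sub 1).div_const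
    (2 * Real.pi ^ 2)
  refine h1.congr_deriv ?_
  have := Real.pi_ne_zero
  simp only [id]
  field_simp

lemma hasGradientAt_sinLin {N : ℕ} (P z : Euc N) :
    HasGradientAt (sinLin P) (WithLp.toLp 2 fun i => P i * Real.cos (2 * Real.pi * z i)) z := by
  refine hasGradientAt_sum_coord
    (h := fun i a => P i * (Real.sin (2 * Real.pi * a) / (2 * Real.pi))) fun i => ?_
  have h1 := (((hasDerivAt_id (z i)).const_mul (2 * Real.pi)).sin.div_const
    (2 * Real.pi)).const_mul (P i)
  refine h1.congr_deriv ?_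
  have := Real.pi_ne_zero
  simp only [id]
  field_simp

lemma norm_sub_cos_le {N : ℕ} (P z : Euc N) :
    ‖P - WithLp.toLp 2 fun i => P i * Real.cos (2 * Real.pi * z i)‖ ≤
      2 * Real.pi ^ 2 * latticeSq z * ‖P‖ := by
  have h0 := latticeSq_nonneg z
  refine abs_le_of_sq_le_sq' ?_ (by positivity) |>.2
  rw [mul_pow, EuclideanSpace.norm_sq_eq, EuclideanSpace.norm_sq_eq, Finset.mul_sum]
  refine Finset.sum_le_sum fun i _ => ?_
  have h1 := latticeSq_term_le z i
  rw [div_le_iff₀ (by positivity)] at h1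
  have h2 := Real.cos_le_one (2 * Real.pi * z i)
  rw [Real.norm_eq_abs, Real.norm_eq_abs, sq_abs, sq_abs]
  have h3 : (P - WithLp.toLp 2 fun i => P i * Real.cos (2 * Real.pi * z i)) i =
      (1 - Real.cos (2 * Real.pi * z i)) * P i := by
    simp; ring
  rw [h3, mul_pow]
  gcongr
  linarith

/-- The test function `-⟨P, ·⟩ + M |·| + A |·|²`, made smooth and periodic. -/
def coneTest {N : ℕ} (P x₀ : Euc N) (M δ A : ℝ) (x : Euc N) : ℝ :=
  M * √(latticeSq (x - x₀) + δ ^ 2) + A * latticeSq (x - x₀) - sinLin P (x - x₀)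

lemma coneTest_periodic {N : ℕ} (P x₀ : Euc N) (M δ A : ℝ) :
    IsZPeriodic (coneTest P x₀ M δ A) := by
  intro x z
  simp only [coneTest, add_sub_right_comm, latticeSq_periodic _ _, sinLin_periodic P _ _]

lemma contDiff_coneTest {N : ℕ} (P x₀ : Euc N) (M : ℝ) {δ : ℝ} (hδ : 0 < δ) (A : ℝ) :
    ContDiff ℝ 1 (coneTest P x₀ M δ A) := by
  have h1 : ContDiff ℝ 1 fun x : Euc N => latticeSq (x - x₀) :=
    contDiff_latticeSq.comp (contDiff_id.sub contDiff_const)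
  have h2 : ContDiff ℝ 1 fun x : Euc N => sinLin P (x - x₀) :=
    (contDiff_sinLin P).comp (contDiff_id.sub contDiff_const)
  have h3 : ContDiff ℝ 1 fun x : Euc N => √(latticeSq (x - x₀) + δ ^ 2) :=
    (h1.add contDiff_const).sqrt fun x => by
      have := latticeSq_nonneg (x - x₀)
      positivity
  exact ((contDiff_const.mul h3).add (contDiff_const.mul h1)).sub h2

lemma gradient_coneTest {N : ℕ} (P x₀ : Euc N) (M : ℝ) {δ : ℝ} (hδ : 0 < δ) (A : ℝ) (x : Euc N) :
    gradient (coneTest P x₀ M δ A) x =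
      (M / √(latticeSq (x - x₀) + δ ^ 2) + 2 * A) • sinVec (x - x₀) -
        WithLp.toLp 2 fun i => P i * Real.cos (2 * Real.pi * (x - x₀) i) := by
  apply HasGradientAt.gradient
  rw [hasGradientAt_iff_hasFDerivAt]
  have hl := (hasGradientAt_latticeSq (x - x₀)).hasFDerivAt.comp x
    ((hasFDerivAt_id x).sub_const x₀)
  have hs := (hasGradientAt_sinLin P (x - x₀)).hasFDerivAt.comp x
    ((hasFDerivAt_id x).sub_const x₀)
  have hpos : 0 < latticeSq (x - x₀) + δ ^ 2 := by
    have := latticeSq_nonneg (x - x₀)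
    positivity
  have hr := (hl.add_const (δ ^ 2)).sqrt hpos.ne'
  have h := ((hr.const_mul M).add (hl.const_mul A)).sub hs
  refine h.congr_fderiv (Eq.symm ?_)
  ext v
  simp
  field_simp

lemma le_norm_gradient_coneTest_add {N : ℕ} (P x₀ : Euc N) {M δ A : ℝ} (hM : 0 ≤ M) (hδ : 0 < δ)
    (hA : 0 ≤ A) (x : Euc N) :
    (M / √(latticeSq (x - x₀) + δ ^ 2) + 2 * A) *
        (√(latticeSq (x - x₀)) * (1 - Real.pi ^ 2 * latticeSq (x - x₀))) -
      2 * Real.pi ^ 2 * latticeSq (x - x₀) * ‖P‖ ≤ ‖gradient (coneTest P x₀ M δ A) x + P‖ := by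
  rw [gradient_coneTest P x₀ M hδ A x, sub_add_eq_add_sub, add_sub_assoc]
  have h1 := norm_sub_cos_le P (x - x₀)
  set v := (M / √(latticeSq (x - x₀) + δ ^ 2) + 2 * A) • sinVec (x - x₀) with hv
  have hnv : ‖v‖ = (M / √(latticeSq (x - x₀) + δ ^ 2) + 2 * A) * ‖sinVec (x - x₀)‖ := by
    rw [hv, norm_smul, Real.norm_of_nonneg (by positivity)]
  have h2 : (M / √(latticeSq (x - x₀) + δ ^ 2) + 2 * A) *
      (√(latticeSq (x - x₀)) * (1 - Real.pi ^ 2 * latticeSq (x - x₀))) ≤ ‖v‖ := by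
    rw [hnv]
    exact mul_le_mul_of_nonneg_left (le_norm_sinVec _) (by positivity)
  have h3 := norm_sub_le_norm_add v (P - WithLp.toLp 2 fun i =>
    P i * Real.cos (2 * Real.pi * (x - x₀) i))
  linarith

lemma HasDerivAt.exists_pos_lt {F : ℝ → ℝ} {F' : ℝ} (h : HasDerivAt F F' 0) (hF' : 0 < F') :
    ∃ t > 0, F 0 < F t := by
  have h1 := (hasDerivAt_iff_tendsto_slope.1 h).eventually (eventually_gt_nhds hF')
  have h2 : ∀ᶠ t in nhdsWithin (0 : ℝ) (Set.Ioi 0), 0 < slope F 0 t :=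
    h1.filter_mono (nhdsWithin_mono _ fun t ht => ne_of_gt ht)
  obtain ⟨t, ht, ht0⟩ := (h2.and self_mem_nhdsWithin).exists
  have ht0 : 0 < t := ht0
  refine ⟨t, ht0, ?_⟩
  rw [slope_def_field, sub_zero] at ht
  linarith [(div_pos_iff_of_pos_right ht0).1 ht]

lemma sqrt_add_sq_le {t s δ : ℝ} (hs : 0 ≤ s) (hδ : 0 ≤ δ) (h : t ≤ s ^ 2) :
    √(t + δ ^ 2) ≤ s + δ := by
  rw [Real.sqrt_le_left (by positivity)]
  nlinarith [mul_nonneg hs hδ]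

lemma exists_max_sub_coneTest {N : ℕ} {u : Euc N → ℝ} {K : NNReal} (hu : LipschitzWith K u)
    (hp : IsZPeriodic u) (P x₀ : Euc N) (M : ℝ) {δ : ℝ} (hδ : 0 < δ) (A : ℝ) :
    ∃ x, gradient (coneTest P x₀ M δ A) x ∈ superDiff u x ∧
      ∀ y, u y - coneTest P x₀ M δ A y ≤ u x - coneTest P x₀ M δ A x := by
  have hc := contDiff_coneTest P x₀ M hδ A
  obtain ⟨x, hx⟩ := exists_max_of_periodic (f := fun y => u y - coneTest P x₀ M δ A y)
    (hu.continuous.sub hc.continuous)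
    (fun y z => by simp only [hp y z, coneTest_periodic P x₀ M δ A y z])
  exact ⟨x, ⟨_, hc, coneTest_periodic P x₀ M δ A, hx, rfl⟩, hx⟩

lemma sub_coneTest_le {N : ℕ} {u : Euc N → ℝ} {K : NNReal} (hu : LipschitzWith K u)
    (hp : IsZPeriodic u) (P x₀ : Euc N) {M : ℝ} (hM : 0 ≤ M) (δ A : ℝ) (x : Euc N) :
    u x - coneTest P x₀ M δ A x ≤
      u x₀ + (2 * K + ‖P‖ + 1) * √(latticeSq (x - x₀)) - A * √(latticeSq (x - x₀)) ^ 2 := by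
  have h1 := (abs_le.1 (hu.abs_sub_le_latticeSq hp x x₀)).2
  have h2 := (abs_le.1 (abs_sinLin_le P (x - x₀))).2
  have h3 : 0 ≤ M * √(latticeSq (x - x₀) + δ ^ 2) := by positivity
  have h4 := Real.sqrt_nonneg (latticeSq (x - x₀))
  rw [Real.sq_sqrt (latticeSq_nonneg _), coneTest]
  linarith

lemma exists_unit_forward_growth {N : ℕ} {ψ : Euc N → ℝ} {x₀ : Euc N}
    (hψ : DifferentiableAt ℝ ψ x₀) (P : Euc N) {M : ℝ} (hM : 0 ≤ M)
    (hMB : M < ‖gradient ψ x₀ + P‖) (A : ℝ) :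
    ∃ e : Euc N, ∃ t : ℝ, ‖e‖ = 1 ∧ 0 < t ∧
      ψ x₀ < ψ (x₀ + t • e) + sinLin P (t • e) - M * t - A * t ^ 2 := by
  set p := gradient ψ x₀ with hp_def
  set B := ‖p + P‖ with hB_def
  have hB0 : 0 < B := hM.trans_lt hMB
  set e := B⁻¹ • (p + P) with he_def
  have he : ‖e‖ = 1 := by
    rw [he_def, norm_smul, norm_inv, Real.norm_of_nonneg hB0.le, inv_mul_cancel₀ hB0.ne']
  have hF : HasDerivAt (fun t : ℝ => ψ (x₀ + t • e) + sinLin P (t • e) - M * t - A * t ^ 2)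
      (B - M) 0 := by
    have h1 : HasDerivAt (fun t : ℝ => t • e) e 0 := by
      simpa using (hasDerivAt_id (0 : ℝ)).smul_const e
    have h2 : HasDerivAt (fun t : ℝ => x₀ + t • e) e 0 := h1.const_add x₀
    have h3 : HasFDerivAt ψ (InnerProductSpace.toDual ℝ (Euc N) p) (x₀ + (0 : ℝ) • e) := by
      rw [zero_smul, add_zero]
      exact hψ.hasGradientAt.hasFDerivAt
    have h4 := (hasGradientAt_sinLin P ((0 : ℝ) • e)).hasFDerivAt.comp_hasDerivAt 0 h1
    have h5 := h3.comp_hasDerivAt 0 h2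
    have h6 := ((h5.add h4).sub ((hasDerivAt_id (0 : ℝ)).const_mul M)).sub
      (((hasDerivAt_id (0 : ℝ)).pow 2).const_mul A)
    refine h6.congr_deriv ?_
    have h7 : inner ℝ p e + inner ℝ P e = B := by
      rw [← inner_add_left, he_def, inner_smul_right, real_inner_self_eq_norm_sq, ← hB_def]
      field_simp
    have h8 : (WithLp.toLp 2 fun i => P i * Real.cos (2 * Real.pi * ((0 : ℝ) • e) i)) = P := by
      ext i; simp
    rw [h8]
    simp [h7]
  obtain ⟨t, ht, hFt⟩ := hF.exists_pos_lt (sub_pos.2 hMB)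
  simp only [zero_smul, add_zero, sinLin_zero, mul_zero, sub_zero, ne_eq, OfNat.ofNat_ne_zero,
    not_false_eq_true, zero_pow] at hFt
  exact ⟨e, t, he, ht, hFt⟩

lemma le_cone_slope_mul {M A s δ : ℝ} (hM : 0 ≤ M) (hA : 0 ≤ A) (hs : 0 < s) (hδ : 0 ≤ δ)
    (h : M * δ ≤ 2 * A * s ^ 2) : M ≤ (M / √(s ^ 2 + δ ^ 2) + 2 * A) * s := by
  have h1 : √(s ^ 2 + δ ^ 2) ≤ s + δ := sqrt_add_sq_le hs.le hδ le_rfl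
  have h2 : M / (s + δ) ≤ M / √(s ^ 2 + δ ^ 2) :=
    div_le_div_of_nonneg_left hM (by positivity) h1
  have h3 : M ≤ (M / (s + δ) + 2 * A) * s := by
    have h4 : 0 ≤ 2 * A * s * δ := by positivity
    have : (M / (s + δ) + 2 * A) * s = (M * s + 2 * A * s * (s + δ)) / (s + δ) := by
      field_simp
    rw [this, le_div_iff₀ (by positivity)]
    linarith
  exact h3.trans (by gcongr)

lemma sq_le_of_div_sqrt_mul_sq_le {C r s : ℝ} (hC : 0 < C) (hr : 0 < r) (hs : 0 ≤ s)
    (h : C / √r * s ^ 2 ≤ C * s) : s ^ 2 ≤ r := by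
  have hr' : 0 < √r := Real.sqrt_pos.2 hr
  rcases hs.eq_or_lt with rfl | hs
  · simpa using hr.le
  · rw [← Real.le_sqrt hs.le hr.le]
    rw [div_mul_eq_mul_div, div_le_iff₀ hr'] at h
    have := mul_pos hC hs
    nlinarith

/-- The rate of growth of a Lipschitz function at a point of its subdifferential is attained,
up to a small error, by elements of its superdifferential at nearby points. -/
lemma exists_superDiff_norm_ge {N : ℕ} {u : Euc N → ℝ} {K : NNReal} (hu : LipschitzWith K u)
    (hp : IsZPeriodic u) (P : Euc N) {x₀ p : Euc N} (hpd : p ∈ subDiff u x₀) {ρ ε : ℝ}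
    (hρ : 0 < ρ) (hε : 0 < ε) :
    ∃ x, ∃ q ∈ superDiff u x, latticeSq (x - x₀) ≤ ρ ∧ ‖p + P‖ - ε ≤ ‖q + P‖ := by
  set K₃ : ℝ := 2 * K + ‖P‖ + 1 with hK₃
  have hK₃0 : 0 < K₃ := by positivity
  rcases le_or_gt ‖p + P‖ ε with hB | hB
  · obtain ⟨x, hxq, hx⟩ := exists_max_sub_coneTest hu hp P x₀ 0 one_pos (K₃ / √ρ)
    refine ⟨x, _, hxq, ?_, by linarith [norm_nonneg (gradient (coneTest P x₀ 0 1 (K₃ / √ρ)) x + P)]⟩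
    have h1 := sub_coneTest_le hu hp P x₀ le_rfl 1 (K₃ / √ρ) x
    have h2 := hx x₀
    have h3 : coneTest P x₀ 0 1 (K₃ / √ρ) x₀ = 0 := by
      simp [coneTest, latticeSq_zero, sinLin_zero]
    rw [← Real.sq_sqrt (latticeSq_nonneg (x - x₀))]
    exact sq_le_of_div_sqrt_mul_sq_le hK₃0 hρ (Real.sqrt_nonneg _) (by linarith)
  · obtain ⟨ψ, hψ, -, hψm, rfl⟩ := hpd
    set p := gradient ψ x₀ with hp_def
    set B := ‖p + P‖ with hB_def
    set M := B - ε / 2 with hM_def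
    have hB0 : 0 < B := by linarith
    have hM : 0 < M := by linarith
    have hpi := Real.pi_pos
    set r := min ρ (min (1 / Real.pi ^ 2) (ε / (2 * Real.pi ^ 2 * (M + 2 * ‖P‖)))) with hr_def
    have hr : 0 < r := by positivity
    set A := K₃ / √r with hA_def
    have hA : 0 < A := div_pos hK₃0 (Real.sqrt_pos.2 hr)
    obtain ⟨e, t, he, ht, hFt⟩ := exists_unit_forward_growth
      ((hψ.differentiable one_ne_zero) x₀) P (M := M) hM.le (by linarith) A
    set η := ψ (x₀ + t • e) + sinLin P (t • e) - M * t - A * t ^ 2 - ψ x₀ with hη_def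
    have hη : 0 < η := by linarith
    set c := η / 2 / K₃ with hc_def
    have hc : 0 < c := by positivity
    set δ := min (η / (2 * M)) (2 * A * c ^ 2 / M) with hδ_def
    have hδ : 0 < δ := by positivity
    have hδ1 : M * δ ≤ η / 2 := by
      have := min_le_left (η / (2 * M)) (2 * A * c ^ 2 / M)
      rw [← hδ_def, le_div_iff₀ (by positivity)] at this
      linarith
    have hδ2 : M * δ ≤ 2 * A * c ^ 2 := by
      have := min_le_right (η / (2 * M)) (2 * A * c ^ 2 / M)
      rw [← hδ_def, le_div_iff₀ (by positivity)] at this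
      linarith
    obtain ⟨x, hxq, hx⟩ := exists_max_sub_coneTest hu hp P x₀ M hδ A
    have hlow : u x₀ + η / 2 ≤ u x - coneTest P x₀ M δ A x := by
      refine le_trans ?_ (hx (x₀ + t • e))
      have h1 : latticeSq (t • e) ≤ t ^ 2 := by
        have := latticeSq_le_norm_sq (t • e)
        rwa [norm_smul, he, mul_one, Real.norm_eq_abs, sq_abs] at this
      have h2 := mul_le_mul_of_nonneg_left (sqrt_add_sq_le ht.le hδ.le h1) hM.le
      have h3 := mul_le_mul_of_nonneg_left h1 hA.le
      have h4 := hψm (x₀ + t • e)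
      rw [coneTest, add_sub_cancel_left]
      linarith
    have hup := sub_coneTest_le hu hp P x₀ hM.le δ A x
    have hgrad := le_norm_gradient_coneTest_add P x₀ hM.le hδ hA.le x
    have hs0 := Real.sqrt_nonneg (latticeSq (x - x₀))
    have hsq := Real.sq_sqrt (latticeSq_nonneg (x - x₀))
    set s := √(latticeSq (x - x₀)) with hs_def
    rw [← hsq] at hgrad
    have hsr : s ^ 2 ≤ r := sq_le_of_div_sqrt_mul_sq_le hK₃0 hr hs0 (by linarith)
    have hcs : c ≤ s := by
      rw [hc_def, div_le_iff₀ hK₃0]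
      nlinarith [mul_nonneg hA.le (sq_nonneg s)]
    have hs : 0 < s := hc.trans_le hcs
    have hκ : M ≤ (M / √(s ^ 2 + δ ^ 2) + 2 * A) * s :=
      le_cone_slope_mul hM.le hA.le hs hδ.le (hδ2.trans (by gcongr))
    refine ⟨x, _, hxq, ?_, le_trans ?_ hgrad⟩
    · rw [← hsq]; exact hsr.trans (min_le_left _ _)
    · have h1 : Real.pi ^ 2 * s ^ 2 ≤ 1 := by
        have := hsr.trans ((min_le_right _ _).trans (min_le_left _ _))
        rw [le_div_iff₀ (by positivity)] at this
        linarith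
      have h2 : s ^ 2 * (2 * Real.pi ^ 2 * (M + 2 * ‖P‖)) ≤ ε := by
        have := hsr.trans ((min_le_right _ _).trans (min_le_right _ _))
        rwa [le_div_iff₀ (by positivity)] at this
      have h3 := mul_le_mul_of_nonneg_right hκ (sub_nonneg.2 h1)
      linarith

lemma gradient_neg_apply {N : ℕ} (φ : Euc N → ℝ) (x : Euc N) :
    gradient (fun y => -φ y) x = -gradient φ x := by
  simp [gradient, fderiv_fun_neg]

lemma gradient_const_mul_apply {N : ℕ} {φ : Euc N → ℝ} {x : Euc N} (hφ : DifferentiableAt ℝ φ x)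
    (k : ℝ) : gradient (fun y => k * φ y) x = k • gradient φ x := by
  simp [gradient, fderiv_const_mul hφ]

lemma neg_mem_subDiff {N : ℕ} {u : Euc N → ℝ} {x q : Euc N}
    (hq : q ∈ superDiff (fun y => -u y) x) : -q ∈ subDiff u x := by
  obtain ⟨φ, hφ, hφp, hmax, rfl⟩ := hq
  refine ⟨fun y => -φ y, hφ.neg, fun y z => by simp only [hφp _ z], fun y => ?_,
    (gradient_neg_apply φ x).symm⟩
  linarith [hmax y]

lemma smul_mem_superDiff {N : ℕ} {u : Euc N → ℝ} {x q : Euc N} {k : ℝ} (hk : 0 < k)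
    (hq : q ∈ superDiff (fun y => k⁻¹ * u y) x) : k • q ∈ superDiff u x := by
  obtain ⟨φ, hφ, hφp, hmax, rfl⟩ := hq
  refine ⟨fun y => k * φ y, contDiff_const.mul hφ, fun y z => by simp only [hφp _ z], fun y => ?_,
    (gradient_const_mul_apply (hφ.differentiable one_ne_zero x) k).symm⟩
  have h := mul_le_mul_of_nonneg_left (hmax y) hk.le
  simpa only [mul_sub, mul_inv_cancel_left₀ hk.ne'] using h

lemma hasGradientAt_mul_latticeSq_sub {N : ℕ} (A : ℝ) (x y : Euc N) :
    HasGradientAt (fun x => A * latticeSq (x - y)) ((2 * A) • sinVec (x - y)) x := by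
  rw [hasGradientAt_iff_hasFDerivAt]
  have h := ((hasGradientAt_latticeSq (x - y)).hasFDerivAt.comp x
    ((hasFDerivAt_id x).sub_const y)).const_mul A
  refine h.congr_fderiv (Eq.symm ?_)
  ext v
  simp
  ring

lemma contDiff_mul_latticeSq_sub {N : ℕ} (A : ℝ) (y : Euc N) :
    ContDiff ℝ 1 fun x : Euc N => A * latticeSq (x - y) :=
  contDiff_const.mul (contDiff_latticeSq.comp (contDiff_id.sub contDiff_const))

lemma mul_latticeSq_sub_periodic {N : ℕ} (A : ℝ) (y : Euc N) :
    IsZPeriodic fun x : Euc N => A * latticeSq (x - y) := by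
  intro x z
  simp only [add_sub_right_comm, latticeSq_periodic _ _]

lemma sinVec_neg {N : ℕ} (z : Euc N) : sinVec (-z) = -sinVec z := by
  ext i
  simp [sinVec, neg_div]

/-- Doubling of variables for periodic Lipschitz functions: a sub- and a supergradient coincide
at two points which are arbitrarily close modulo the lattice. -/
lemma exists_common_gradient {N : ℕ} {u v : Euc N → ℝ} {K : NNReal} (hu : Continuous u)
    (hup : IsZPeriodic u) (hv : LipschitzWith K v) (hvp : IsZPeriodic v) {ρ : ℝ} (hρ : 0 < ρ) :
    ∃ x y q, q ∈ superDiff u x ∧ q ∈ subDiff v y ∧ latticeSq (x - y) ≤ ρ := by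
  set A : ℝ := (2 * K + 1) / √ρ
  obtain ⟨x, y, hmax⟩ := exists_max_of_periodic_prod
    (F := fun p => u p.1 - v p.2 - A * latticeSq (p.1 - p.2))
    ((hu.comp continuous_fst |>.sub (hv.continuous.comp continuous_snd)).sub
      (continuous_const.mul (contDiff_latticeSq.continuous.comp
        (continuous_fst.sub continuous_snd))))
    (fun y x z => by simp only [hup x z, mul_latticeSq_sub_periodic A y x z])
    (fun x y z => by
      have := mul_latticeSq_sub_periodic A x y z
      simp only [← latticeSq_neg (x - _), neg_sub, hvp y z, this])
  refine ⟨x, y, (2 * A) • sinVec (x - y),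
    ⟨fun x => A * latticeSq (x - y), contDiff_mul_latticeSq_sub A y,
      mul_latticeSq_sub_periodic A y, fun x' => ?_,
      (hasGradientAt_mul_latticeSq_sub A x y).gradient.symm⟩,
    ⟨fun y => -A * latticeSq (y - x), contDiff_mul_latticeSq_sub (-A) x,
      mul_latticeSq_sub_periodic (-A) x, fun y' => ?_, ?_⟩, ?_⟩
  · have := hmax x' y
    simp only at this
    linarith
  · have := hmax x y'
    simp only [← latticeSq_neg (x - _), neg_sub] at this
    linarith
  · rw [(hasGradientAt_mul_latticeSq_sub (-A) y x).gradient, ← neg_sub x y, sinVec_neg, smul_neg,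
      mul_neg, neg_smul, neg_neg]
  · have h1 := hmax x x
    simp only [sub_self, latticeSq_zero, mul_zero, sub_zero] at h1
    have h2 := (abs_le.1 (hv.abs_sub_le_latticeSq hvp x y)).2
    have h3 := Real.sqrt_nonneg (latticeSq (x - y))
    have h4 := Real.sq_sqrt (latticeSq_nonneg (x - y))
    rw [← h4]
    refine sq_le_of_div_sqrt_mul_sq_le (C := 2 * K + 1) (by positivity) hρ h3 ?_
    rw [h4]
    linarith

lemma exists_coefficient_modulus {N : ℕ} {σ : Euc N → ℝ} (hσc : Continuous σ)
    (hσp : IsZPeriodic σ) (hσpos : ∀ x, 0 < σ x) (a : ℝ) {η : ℝ} (hη : 0 < η) :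
    ∃ ρ > 0, ∀ x y G, latticeSq (x - y) ≤ ρ → 0 ≤ G → σ x * G ≤ a → σ y * G ≤ a + η := by
  obtain ⟨x₀, hx₀⟩ := exists_max_of_periodic (f := fun x => -σ x) hσc.neg
    (fun x z => by simp only [hσp _ z])
  have h0 := hσpos x₀
  obtain ⟨ρ, hρ, h⟩ := exists_latticeSq_modulus hσc hσp
    (η := η * σ x₀ / (|a| + 1)) (by positivity)
  refine ⟨ρ, hρ, fun x y G hxy hG hx => ?_⟩
  have h1 := (abs_le.1 (h x y hxy)).1
  have h2 : σ x₀ * G ≤ |a| + 1 := by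
    have := mul_le_mul_of_nonneg_right (neg_le_neg_iff.1 (hx₀ x)) hG
    linarith [le_abs_self a]
  have h3 : η * σ x₀ / (|a| + 1) * G ≤ η := by
    rw [div_mul_eq_mul_div, div_le_iff₀ (by positivity), mul_assoc]
    exact mul_le_mul_of_nonneg_left h2 hη.le
  have h4 := mul_le_mul_of_nonneg_right h1 hG
  linarith

lemma comparison_cell {N : ℕ} {σ : Euc N → ℝ} (hσc : Continuous σ) (hσp : IsZPeriodic σ)
    (hσpos : ∀ x, 0 < σ x) {g : ℝ → ℝ} (hg : ∀ r, 0 ≤ r → 0 ≤ g r) {P : Euc N} {a b : ℝ}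
    {u v : Euc N → ℝ} {K : NNReal} (hu : Continuous u) (hup : IsZPeriodic u)
    (hv : LipschitzWith K v) (hvp : IsZPeriodic v)
    (hsub : IsCellSubsolution (fun x p => σ x * g ‖p‖) P a u)
    (hsuper : IsCellSupersolution (fun x p => σ x * g ‖p‖) P b v) : b ≤ a := by
  refine le_of_forall_pos_le_add fun η hη => ?_
  obtain ⟨ρ, hρ, h⟩ := exists_coefficient_modulus hσc hσp hσpos a hη
  obtain ⟨x, y, q, hqu, hqv, hxy⟩ := exists_common_gradient hu hup hv hvp hρ
  exact (hsuper y q hqv).trans (h x y _ hxy (hg _ (norm_nonneg _)) (hsub x q hqu))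

/-- Since the Hamiltonian is nondecreasing in `‖p‖`, its sublevel sets are convex, and the
subsolution property extends from the superdifferential to the subdifferential. -/
lemma IsCellSubsolution.le_of_mem_subDiff {N : ℕ} {σ : Euc N → ℝ} (hσc : Continuous σ)
    (hσp : IsZPeriodic σ) (hσpos : ∀ x, 0 < σ x) {g : ℝ → ℝ} {L : NNReal}
    (hg : ∀ r, 0 ≤ r → 0 ≤ g r) (hgmono : MonotoneOn g (Set.Ici 0))
    (hgLip : LipschitzOnWith L g (Set.Ici 0)) {P : Euc N} {a : ℝ} {u : Euc N → ℝ} {K : NNReal}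
    (hu : LipschitzWith K u) (hup : IsZPeriodic u)
    (hsub : IsCellSubsolution (fun x p => σ x * g ‖p‖) P a u) {x p : Euc N}
    (hpd : p ∈ subDiff u x) : σ x * g ‖p + P‖ ≤ a := by
  refine le_of_forall_pos_le_add fun η hη => ?_
  have hx := hσpos x
  set ε := η / 2 / (σ x * (L + 1)) with hε_def
  have hε : 0 < ε := by positivity
  obtain ⟨ρ, hρ, h⟩ := exists_coefficient_modulus hσc hσp hσpos a (half_pos hη)
  obtain ⟨y, q, hq, hyx, hpq⟩ := exists_superDiff_norm_ge hu hup P hpd hρ hε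
  have h1 := h y x _ hyx (hg _ (norm_nonneg (q + P))) (hsub y q hq)
  have h2 : g ‖p + P‖ ≤ g ‖q + P‖ + L * ε := by
    rcases le_total ‖p + P‖ ‖q + P‖ with hle | hle
    · have := hgmono (Set.mem_Ici.2 (norm_nonneg _)) (Set.mem_Ici.2 (norm_nonneg _)) hle
      have : 0 ≤ L * ε := by positivity
      linarith
    · have h3 := hgLip.dist_le_mul _ (Set.mem_Ici.2 (norm_nonneg (p + P))) _
        (Set.mem_Ici.2 (norm_nonneg (q + P)))
      rw [Real.dist_eq, Real.dist_eq, abs_of_nonneg (sub_nonneg.2 hle)] at h3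
      have h4 : (L : ℝ) * (‖p + P‖ - ‖q + P‖) ≤ L * ε := by
        gcongr
        linarith
      linarith [le_abs_self (g ‖p + P‖ - g ‖q + P‖)]
  have h5 : σ x * (L * ε) ≤ η / 2 := by
    have h6 : σ x * (L + 1) * ε = η / 2 := by
      rw [hε_def]
      field_simp
    nlinarith [mul_pos hx hε]
  have h7 := mul_le_mul_of_nonneg_left h2 hx.le
  linarith

/-- Properties of the generalized effective Hamiltonian:
Lipschitz continuity with constant `σ̄ L`, radial monotonicity, and evenness. -/
theorem generalized_effective_hamiltonian_properties {N : ℕ} (hN : 1 ≤ N)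
    (σ : Euc N → ℝ) (m : ℝ → ℝ) (L : NNReal)
    (hσc : Continuous σ) (hσp : IsZPeriodic σ) (hσpos : ∀ x, 0 < σ x)
    (hm01 : ∀ r : ℝ, 0 ≤ r → 0 < m r ∧ m r < 1)
    (hmLip : LipschitzOnWith L m (Set.Ici 0))
    (hmmono : StrictMonoOn m (Set.Ici 0))
    (hmlim : Tendsto m atTop (nhds 1))
    (σmax : ℝ) (hσmax : IsGreatest (Set.range σ) σmax)
    (c : ℕ → Euc N → ℝ)
    (hc : ∀ (n : ℕ) (P : Euc N), ∃ u : Euc N → ℝ,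
        IsCellSolution (fun x p => σ x * max (m ‖p‖) ((L : ℝ) * ‖p‖ - n)) P u (c n P))
    (Hinf : Euc N → ℝ)
    (hHinf : ∀ P : Euc N, Tendsto (fun n => c n P) atTop (nhds (Hinf P))) :
    (∀ P Q : Euc N, |Hinf P - Hinf Q| ≤ σmax * (L : ℝ) * ‖P - Q‖) ∧
    (∀ (P : Euc N) (k : ℝ), 1 ≤ k → Hinf P ≤ Hinf (k • P)) ∧
    (∀ P : Euc N, Hinf P = Hinf (-P)) := by
  set g : ℕ → ℝ → ℝ := fun n r => max (m r) ((L : ℝ) * r - n) with hg_def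
  have hg0 : ∀ n r, 0 ≤ r → 0 ≤ g n r := fun n r hr => le_max_of_le_left (hm01 r hr).1.le
  have hgmono : ∀ n, MonotoneOn (g n) (Set.Ici 0) := fun n r hr s hs hrs =>
    max_le_max (hmmono.monotoneOn hr hs hrs)
      (sub_le_sub_right (mul_le_mul_of_nonneg_left hrs L.coe_nonneg) _)
  have hgLip : ∀ n, LipschitzOnWith L (g n) (Set.Ici 0) := by
    intro n
    refine LipschitzOnWith.of_dist_le_mul fun r hr s hs => ?_
    have h1 := hmLip.dist_le_mul r hr s hs
    simp only [Real.dist_eq] at h1 ⊢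
    refine (abs_max_sub_max_le_max _ _ _ _).trans (max_le h1 ?_)
    rw [sub_sub_sub_cancel_right, ← mul_sub, abs_mul, NNReal.abs_eq]
  choose u hu using hc
  refine ⟨?_, fun P k hk => ?_, ?_⟩
  · have key : ∀ P Q, Hinf Q ≤ Hinf P + σmax * (L : ℝ) * ‖P - Q‖ := by
      intro P Q
      refine le_of_tendsto_of_tendsto' (hHinf Q) ((hHinf P).add_const _) fun n => ?_
      obtain ⟨⟨K, hK⟩, hper, hsub, -⟩ := hu n P
      obtain ⟨⟨K', hK'⟩, hper', -, hsup⟩ := hu n Q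
      refine comparison_cell hσc hσp hσpos (hg0 n) hK.continuous hper hK' hper' ?_ hsup
      intro x q hq
      have h1 : σ x * g n ‖q + P‖ ≤ c n P := hsub x q hq
      have h2 := (hgLip n).dist_le_mul _ (Set.mem_Ici.2 (norm_nonneg (q + Q))) _
        (Set.mem_Ici.2 (norm_nonneg (q + P)))
      rw [Real.dist_eq, Real.dist_eq] at h2
      have h3 : |‖q + Q‖ - ‖q + P‖| ≤ ‖P - Q‖ := by
        have := abs_norm_sub_norm_le (q + Q) (q + P)
        rwa [add_sub_add_left_eq_sub, norm_sub_rev] at this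
      have h4 : g n ‖q + Q‖ ≤ g n ‖q + P‖ + L * ‖P - Q‖ := by
        have := mul_le_mul_of_nonneg_left h3 L.coe_nonneg
        linarith [le_abs_self (g n ‖q + Q‖ - g n ‖q + P‖)]
      have h5 := mul_le_mul_of_nonneg_left h4 (hσpos x).le
      have h6 : σ x * (L * ‖P - Q‖) ≤ σmax * (L * ‖P - Q‖) :=
        mul_le_mul_of_nonneg_right (hσmax.2 ⟨x, rfl⟩) (by positivity)
      linarith
    intro P Q
    have h1 := key P Q
    have h2 := key Q P
    rw [norm_sub_rev] at h2
    exact abs_sub_le_iff.2 ⟨by linarith, by linarith⟩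
  · refine le_of_tendsto_of_tendsto' (hHinf P) (hHinf (k • P)) fun n => ?_
    have hk0 : 0 < k := one_pos.trans_le hk
    obtain ⟨⟨K, hK⟩, hper, hsub, -⟩ := hu n (k • P)
    obtain ⟨⟨K', hK'⟩, hper', -, hsup⟩ := hu n P
    refine comparison_cell hσc hσp hσpos (hg0 n) (u := fun x => k⁻¹ * u n (k • P) x)
      (continuous_const.mul hK.continuous) (fun x z => by simp only [hper _ z]) hK' hper' ?_ hsup
    intro x q hq
    refine le_trans ?_ (hsub x (k • q) (smul_mem_superDiff hk0 hq))
    refine mul_le_mul_of_nonneg_left ?_ (hσpos x).le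
    refine hgmono n (Set.mem_Ici.2 (norm_nonneg _)) (Set.mem_Ici.2 (norm_nonneg _)) ?_
    rw [← smul_add, norm_smul, Real.norm_of_nonneg hk0.le]
    exact le_mul_of_one_le_left (norm_nonneg _) hk
  · have key : ∀ P, Hinf (-P) ≤ Hinf P := by
      intro P
      refine le_of_tendsto_of_tendsto' (hHinf (-P)) (hHinf P) fun n => ?_
      obtain ⟨⟨K, hK⟩, hper, hsub, -⟩ := hu n P
      obtain ⟨⟨K', hK'⟩, hper', -, hsup⟩ := hu n (-P)
      refine comparison_cell hσc hσp hσpos (hg0 n) (u := fun x => -u n P x)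
        hK.continuous.neg (fun x z => by simp only [hper _ z]) hK' hper' ?_ hsup
      intro x q hq
      have h := IsCellSubsolution.le_of_mem_subDiff hσc hσp hσpos (hg0 n) (hgmono n) (hgLip n)
        hK hper hsub (neg_mem_subDiff hq)
      rwa [← norm_neg, neg_add, neg_neg] at h
    intro P
    refine le_antisymm ?_ (key P)
    have := key (-P)
    rwa [neg_neg] at this
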